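/- arXiv:2510.06792 — 2 statements merged into one kernel-verified Lean document; each statement's English description precedes it below -/
import Mathlib

section
/- Let s, t ∈ ℂ with s ≠ 0 and let f(x,y) = x³y + x²y³ + s y⁸ + t y⁹ (the family Z_{1,1}). Then f does not deform to J_{3,0}: for every integer m ≥ 1 and every function F(x,y,u), analytic on a neighborhood of 0 in ℂ² × ℂ^m, with F(x,y,0) = f(x,y), there exists ε > 0 such that for every u ∈ ℂ^m with 0 < ‖u‖ < ε, the germ at 0 of (x,y) ↦ F(x,y,u) is not right equivalent to the germ at 0 of x³ + b x²y³ + y⁹ + c x y⁷ for any b, c ∈ ℂ with 4b³ + 27 ≠ 0. -/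
open Filter

/-- The germs at `0` of `g₁` and `g₂` are (smoothly/holomorphically) right equivalent:
there is a map `φ`, analytic on a neighborhood of `0`, with `φ 0 = 0` and invertible
derivative at `0`, such that `g₁ = g₂ ∘ φ` near `0`. -/
def RightEquiv (g₁ g₂ : ℂ × ℂ → ℂ) : Prop :=
  ∃ φ : ℂ × ℂ → ℂ × ℂ, φ 0 = 0 ∧ AnalyticAt ℂ φ 0 ∧
    (∃ L : (ℂ × ℂ) ≃L[ℂ] ℂ × ℂ, fderiv ℂ φ 0 = (L : (ℂ × ℂ) →L[ℂ] ℂ × ℂ)) ∧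
    ∀ᶠ p in nhds (0 : ℂ × ℂ), g₁ p = g₂ (φ p)

/-- The normal form `x³ + b x² y³ + y⁹ + c x y⁷` of the class `J_{3,0}`. -/
noncomputable def J30 (b c : ℂ) (p : ℂ × ℂ) : ℂ :=
  p.1 ^ 3 + b * p.1 ^ 2 * p.2 ^ 3 + p.2 ^ 9 + c * p.1 * p.2 ^ 7

open Asymptotics Topology

theorem Polynomial.coeff_eq_zero_of_eval_isBigO (N : ℕ) (q : Polynomial ℂ)
    (h : (fun z : ℂ => q.eval z) =O[𝓝[≠] 0] fun z => z ^ N) : ∀ n < N, q.coeff n = 0 := by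
  induction N generalizing q with
  | zero => simp
  | succ N ih =>
    have h0 : q.coeff 0 = 0 := by
      have hq : Tendsto (fun z : ℂ => q.eval z) (𝓝[≠] 0) (𝓝 (q.eval 0)) :=
        (q.continuous.tendsto 0).mono_left nhdsWithin_le_nhds
      have hz : Tendsto (fun z : ℂ => z ^ (N + 1)) (𝓝[≠] 0) (𝓝 0) := by
        have := ((continuous_pow (M := ℂ) (N + 1)).tendsto 0).mono_left
          (nhdsWithin_le_nhds (s := {0}ᶜ))
        simpa using this
      rw [Polynomial.coeff_zero_eq_eval_zero]
      exact tendsto_nhds_unique hq (h.trans_tendsto hz)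
    have hdiv : ∀ z : ℂ, q.eval z = q.divX.eval z * z := by
      intro z
      conv_lhs => rw [← q.divX_mul_X_add]
      simp [h0]
    have hO : (fun z : ℂ => q.divX.eval z) =O[𝓝[≠] 0] fun z => z ^ N := by
      have := h.mul (isBigO_refl (fun z : ℂ => z⁻¹) (𝓝[≠] 0))
      refine (this.congr' ?_ ?_)
      · filter_upwards [self_mem_nhdsWithin] with z hz
        rw [hdiv, mul_assoc, mul_inv_cancel₀ hz, mul_one]
      · filter_upwards [self_mem_nhdsWithin] with z hz
        rw [pow_succ, mul_assoc, mul_inv_cancel₀ hz, mul_one]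
    intro n hn
    cases n with
    | zero => exact h0
    | succ n => rw [← Polynomial.coeff_divX]; exact ih _ hO n (by omega)

theorem Polynomial.coeff_C_add_C_mul_X_pow (a b : ℂ) (i l : ℕ) :
    ((Polynomial.C a + Polynomial.C b * Polynomial.X) ^ i).coeff l
      = i.choose l * a ^ (i - l) * b ^ l := by
  have : (Polynomial.C a + Polynomial.C b * Polynomial.X) ^ i
      = ((Polynomial.X + Polynomial.C a) ^ i).comp (Polynomial.C b * Polynomial.X) := by
    simp [add_comm]
  rw [this, Polynomial.comp_C_mul_X_coeff, Polynomial.coeff_X_add_C_pow]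
  ring

/-- The coefficient of `x ^ i * y ^ (k - i)` in `D (x • v + y • w, …, x • v + y • w)`. -/
noncomputable def mixedCoeff {V : Type*} [NormedAddCommGroup V] [NormedSpace ℂ V] {k : ℕ}
    (D : ContinuousMultilinearMap ℂ (fun _ : Fin k => V) ℂ) (v w : V) (i : ℕ) : ℂ :=
  ∑ s ∈ Finset.powersetCard i Finset.univ, D (s.piecewise (fun _ => v) (fun _ => w))

section
variable {V : Type*} [NormedAddCommGroup V] [NormedSpace ℂ V] {k : ℕ}

theorem apply_smul_add_smul_eq_sum_mixedCoeff
    (D : ContinuousMultilinearMap ℂ (fun _ : Fin k => V) ℂ) (v w : V) (x y : ℂ) :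
    D (fun _ => x • v + y • w)
      = ∑ i ∈ Finset.range (k + 1), mixedCoeff D v w i * x ^ i * y ^ (k - i) := by
  have hs : ∀ s : Finset (Fin k), D (s.piecewise (fun _ => x • v) (fun _ => y • w))
      = D (s.piecewise (fun _ => v) (fun _ => w)) * x ^ s.card * y ^ (k - s.card) := by
    intro s
    have : s.piecewise (fun _ => x • v) (fun _ => y • w)
        = fun i => (s.piecewise (fun _ => x) (fun _ => y) : Fin k → ℂ) i •
          (s.piecewise (fun _ => v) (fun _ => w) : Fin k → V) i := by
      funext i
      by_cases hi : i ∈ s <;> simp [hi]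
    rw [this, D.map_smul_univ, Finset.prod_piecewise]
    simp [Finset.card_sdiff]
    ring
  have := D.map_add_univ (fun _ => x • v) (fun _ => y • w)
  rw [show (fun _ => x • v + y • w : Fin k → V) = (fun _ => x • v) + (fun _ => y • w) from rfl,
    this, ← Finset.powerset_univ, Finset.sum_powerset]
  simp only [Finset.card_univ, Fintype.card_fin]
  refine Finset.sum_congr rfl fun i _ => ?_
  rw [mixedCoeff, Finset.sum_mul, Finset.sum_mul]
  refine Finset.sum_congr rfl fun s hs' => ?_
  rw [hs, (Finset.mem_powersetCard.1 hs').2]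

theorem Filter.Tendsto.mixedCoeff {α : Type*} {l : Filter α}
    {D : α → ContinuousMultilinearMap ℂ (fun _ : Fin k => V) ℂ}
    {D₀ : ContinuousMultilinearMap ℂ (fun _ : Fin k => V) ℂ} {v w : α → V} {v₀ w₀ : V}
    (hD : Tendsto D l (𝓝 D₀)) (hv : Tendsto v l (𝓝 v₀)) (hw : Tendsto w l (𝓝 w₀)) (i : ℕ) :
    Tendsto (fun a => mixedCoeff (D a) (v a) (w a) i) l (𝓝 (mixedCoeff D₀ v₀ w₀ i)) := by
  refine tendsto_finsetSum _ fun s _ => ?_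
  refine hD.eval (tendsto_pi_nhds.2 fun j => ?_)
  by_cases hj : j ∈ s <;> simpa [hj]

end

/-- The Taylor polynomials at `0` of an analytic family depend continuously on the parameter. -/
theorem exists_taylor_family {E : Type*} [NormedAddCommGroup E] [NormedSpace ℂ E]
    (F : (ℂ × ℂ) × E → ℂ) (hF : AnalyticAt ℂ F 0) (N : ℕ) :
    ∃ D : ∀ k : ℕ, E → ContinuousMultilinearMap ℂ (fun _ : Fin k => ℂ × ℂ) ℂ,
      (∀ k, ContinuousAt (D k) 0) ∧
      ∀ᶠ u in 𝓝 (0 : E), (fun p => F (p, u) - ∑ k ∈ Finset.range N, D k u (fun _ => p))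
        =O[𝓝 0] fun p => ‖p‖ ^ N := by
  obtain ⟨P, r, hP⟩ := hF
  refine ⟨fun k u => (P.changeOrigin (0, u) k).compContinuousLinearMap
    (fun _ => ContinuousLinearMap.inl ℂ (ℂ × ℂ) E), fun k => ?_, ?_⟩
  · have h1 : ContinuousAt (fun u : E => P.changeOrigin ((0 : ℂ × ℂ), u) k) 0 := by
      have := (P.analyticAt_changeOrigin hP.radius_pos k).continuousAt
      exact ContinuousAt.comp (f := fun u : E => ((0 : ℂ × ℂ), u)) (x := 0) this
        (by fun_prop)
    exact (ContinuousMultilinearMap.compContinuousLinearMapL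
      (fun _ : Fin k => ContinuousLinearMap.inl ℂ (ℂ × ℂ) E)).continuous.continuousAt.comp h1
  · have hball : ∀ᶠ u in 𝓝 (0 : E), ((0 : ℂ × ℂ), u) ∈ Metric.eball (0 : (ℂ × ℂ) × E) r := by
      have : Continuous fun u : E => ((0 : ℂ × ℂ), u) := by fun_prop
      exact this.continuousAt.eventually_mem (Metric.eball_mem_nhds _ hP.r_pos)
    filter_upwards [hball] with u hu
    have h := (hP.changeOrigin (y := ((0 : ℂ × ℂ), u))
      (mem_eball_zero_iff.1 hu)).hasFPowerSeriesAt.isBigO_sub_partialSum_pow N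
    have hi : Tendsto (fun p : ℂ × ℂ => (p, (0 : E))) (𝓝 0) (𝓝 0) := by
      have : Continuous fun p : ℂ × ℂ => (p, (0 : E)) := by fun_prop
      exact this.tendsto 0
    refine (h.comp_tendsto hi).congr ?_ ?_
    · intro p
      simp [FormalMultilinearSeries.partialSum]
    · intro p
      simp

/-- The arc `τ ↦ τ w + (a τ² + h τ³) v`. -/
def cubicArc (v w : ℂ × ℂ) (a h τ : ℂ) : ℂ × ℂ := (a * τ ^ 2 + h * τ ^ 3) • v + τ • w

theorem continuous_cubicArc (v w : ℂ × ℂ) (a h : ℂ) : Continuous (cubicArc v w a h) := by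
  unfold cubicArc; fun_prop

theorem tendsto_cubicArc (v w : ℂ × ℂ) (a h : ℂ) :
    Tendsto (cubicArc v w a h) (𝓝 0) (𝓝 0) := by
  simpa [cubicArc] using (continuous_cubicArc v w a h).tendsto 0

theorem cubicArc_isBigO (v w : ℂ × ℂ) (a h : ℂ) :
    cubicArc v w a h =O[𝓝 0] fun τ => τ := by
  have h1 : (fun τ : ℂ => (a * τ + h * τ ^ 2) • v + w) =O[𝓝 0] fun _ => (1 : ℂ) :=
    (Continuous.tendsto (by fun_prop) 0).isBigO_one ℂ
  refine ((isBigO_refl (fun τ : ℂ => τ) (𝓝 0)).smul h1).congr (fun τ => ?_) (fun τ => ?_)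
  · simp only [cubicArc, smul_add, smul_smul]; ring_nf
  · simp

theorem exists_cubicArc_isBigO (g : ℂ × ℂ → ℂ) (hg : AnalyticAt ℂ g 0) (hg0 : g 0 = 0)
    (v w : ℂ × ℂ) (hv : fderiv ℂ g 0 v ≠ 0) (hw : fderiv ℂ g 0 w = 0) :
    ∃ a : ℂ, ∀ h : ℂ, (fun τ => g (cubicArc v w a h τ)) =O[𝓝 0] fun τ => τ ^ 3 := by
  obtain ⟨P, hP⟩ := hg
  have hP1 : ∀ x, P 1 (fun _ => x) = fderiv ℂ g 0 x := fun x => by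
    rw [hP.fderiv_eq]; rfl
  set A := fderiv ℂ g 0
  set κ := P 2 (fun _ => w) with hκ
  refine ⟨-κ / A v, fun h => ?_⟩
  set a := -κ / A v with ha
  have haA : a * A v = -κ := by rw [ha]; field_simp
  have hline : Tendsto (fun τ : ℂ => τ • w) (𝓝 0) (𝓝 0) := by
    have : Continuous fun τ : ℂ => τ • w := by fun_prop
    simpa using this.tendsto 0
  have hτ : (fun τ : ℂ => τ • w) =O[𝓝 0] fun τ => τ := by
    exact isBigO_of_le' (c := ‖w‖) _ fun τ => by rw [norm_smul, mul_comm]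
  have hquad : (fun τ : ℂ => g (τ • w) - κ * τ ^ 2) =O[𝓝 0] fun τ => τ ^ 3 := by
    have h1 := (hP.isBigO_sub_partialSum_pow 3).comp_tendsto hline
    have h2 : (fun τ : ℂ => ‖τ • w‖ ^ 3) =O[𝓝 0] fun τ => τ ^ 3 := hτ.norm_left.pow 3
    refine (h1.trans h2).congr_left fun τ => ?_
    have e0 : P 0 (fun _ => τ • w) = 0 := by rw [hP.coeff_zero, hg0]
    have e1 : P 1 (fun _ => τ • w) = 0 := by rw [hP1, map_smul, hw, smul_zero]
    have e2 : P 2 (fun _ => τ • w) = κ * τ ^ 2 := by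
      rw [(P 2).map_smul_univ (fun _ => τ) (fun _ => w)]; simp [hκ, mul_comm]
    simp [FormalMultilinearSeries.partialSum, Finset.sum_range_succ, e0, e1, e2]
  have hdiff : (fun τ : ℂ => g (cubicArc v w a h τ) - g (τ • w) - (a * τ ^ 2 + h * τ ^ 3) * A v)
      =O[𝓝 0] fun τ => τ ^ 3 := by
    have hpair : Tendsto (fun τ : ℂ => (cubicArc v w a h τ, τ • w)) (𝓝 0) (𝓝 (0, 0)) :=
      (tendsto_cubicArc v w a h).prodMk_nhds hline
    have h1 := hP.isBigO_image_sub_norm_mul_norm_sub.comp_tendsto hpair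
    have h2 : (fun τ : ℂ => (a * τ ^ 2 + h * τ ^ 3) • v) =O[𝓝 0] fun τ => τ ^ 2 := by
      have h3 : (fun τ : ℂ => (a + h * τ) • v) =O[𝓝 0] fun _ => (1 : ℂ) :=
        (Continuous.tendsto (by fun_prop) 0).isBigO_one ℂ
      refine ((isBigO_refl (fun τ : ℂ => τ ^ 2) (𝓝 0)).smul h3).congr (fun τ => ?_) (fun τ => ?_)
      · simp only [smul_smul]; ring_nf
      · simp
    have h3 := ((cubicArc_isBigO v w a h).prod_left hτ).norm_left.mul h2.norm_left
    refine (h1.trans (h3.congr (fun τ => ?_) (fun τ => ?_))).congr_left fun τ => ?_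
    · simp [cubicArc]
    · ring
    · simp [cubicArc, hP1]
  have hcub : (fun τ : ℂ => h * A v * τ ^ 3) =O[𝓝 0] fun τ => τ ^ 3 :=
    (isBigO_refl _ _).const_mul_left _
  refine ((hquad.add hdiff).add hcub).congr_left fun τ => ?_
  linear_combination (-τ ^ 2) * haA

theorem J30_isBigO {X Y : ℂ → ℂ} (b c : ℂ) (hX : X =O[𝓝 0] fun τ => τ ^ 3)
    (hY : Y =O[𝓝 0] fun τ => τ) :
    (fun τ => J30 b c (X τ, Y τ)) =O[𝓝 0] fun τ => τ ^ 9 := by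
  have h1 : (fun τ => X τ ^ 3) =O[𝓝 0] fun τ => τ ^ 9 :=
    (hX.pow 3).congr_right fun τ => by ring
  have h2 : (fun τ => b * X τ ^ 2 * Y τ ^ 3) =O[𝓝 0] fun τ => τ ^ 9 :=
    (((hX.pow 2).const_mul_left b).mul (hY.pow 3)).congr_right fun τ => by ring
  have h3 : (fun τ => Y τ ^ 9) =O[𝓝 0] fun τ => τ ^ 9 := hY.pow 9
  have h4 : (fun τ => c * X τ * Y τ ^ 7) =O[𝓝 0] fun τ => τ ^ 9 := by
    refine ((hX.const_mul_left c).mul (hY.pow 7)).trans ?_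
    have : (fun τ : ℂ => τ ^ 9 * τ) =O[𝓝 0] fun τ => τ ^ 9 * 1 :=
      (isBigO_refl _ _).mul ((continuous_id.tendsto (0 : ℂ)).isBigO_one ℂ)
    exact this.congr (fun τ => by ring) (fun τ => by ring)
  exact ((h1.add h2).add h3).add h4

/-- A germ right equivalent to a `J_{3,0}` germ vanishes to order `9` along all cubic
perturbations of some parabola, whose tangent line lies in one of two affine charts. -/
theorem RightEquiv.exists_cubicArc {g : ℂ × ℂ → ℂ} {b c : ℂ} (h : RightEquiv g (J30 b c)) :
    ∃ q : ℂ, ‖q‖ ≤ 1 ∧ ∃ a : ℂ,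
      (∀ h, (fun τ => g (cubicArc (1, 0) (q, 1) a h τ)) =O[𝓝 0] fun τ => τ ^ 9) ∨
      (∀ h, (fun τ => g (cubicArc (0, 1) (1, q) a h τ)) =O[𝓝 0] fun τ => τ ^ 9) := by
  obtain ⟨φ, hφ0, hφ, ⟨L, hL⟩, hg⟩ := h
  have hφ1 : AnalyticAt ℂ (fun p => (φ p).1) 0 := analyticAt_fst.comp hφ
  have hφ2 : AnalyticAt ℂ (fun p => (φ p).2) 0 := analyticAt_snd.comp hφ
  have hA : ∀ x, fderiv ℂ (fun p => (φ p).1) 0 x = (L x).1 := fun x => by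
    rw [fderiv.fst hφ.differentiableAt, hL]; rfl
  set A := fderiv ℂ (fun p => (φ p).1) 0 with hAdef
  have hAsplit : ∀ x y : ℂ, A (x, y) = x * A (1, 0) + y * A (0, 1) := fun x y => by
    rw [show ((x, y) : ℂ × ℂ) = x • (1, 0) + y • (0, 1) by simp, map_add, map_smul, map_smul]
    simp
  have key : ∀ v w : ℂ × ℂ, A v ≠ 0 → A w = 0 → ∃ a, ∀ h,
      (fun τ => g (cubicArc v w a h τ)) =O[𝓝 0] fun τ => τ ^ 9 := by
    intro v w hv hw
    obtain ⟨a, ha⟩ := exists_cubicArc_isBigO _ hφ1 (by simp [hφ0]) v w hv hw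
    refine ⟨a, fun h => ?_⟩
    have hY : (fun τ => (φ (cubicArc v w a h τ)).2) =O[𝓝 0] fun τ => τ := by
      have h1 := hφ2.differentiableAt.isBigO_sub.comp_tendsto (tendsto_cubicArc v w a h)
      refine ((h1.congr (fun τ => ?_) (fun τ => ?_))).trans (cubicArc_isBigO v w a h)
      · simp [hφ0]
      · simp
    refine (J30_isBigO b c (ha h) hY).congr' ?_ EventuallyEq.rfl
    filter_upwards [(tendsto_cubicArc v w a h).eventually hg] with τ hτ
    exact hτ.symm
  have hne : A (1, 0) ≠ 0 ∨ A (0, 1) ≠ 0 := by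
    by_contra! hcon
    have h1 := hA (L.symm (1, 0))
    rw [L.apply_symm_apply] at h1
    have h2 := hAsplit (L.symm (1, 0)).1 (L.symm (1, 0)).2
    rw [hcon.1, hcon.2, Prod.mk.eta, h1] at h2
    simp at h2
  rcases le_total ‖A (0, 1)‖ ‖A (1, 0)‖ with hle | hle
  · have h0 : A (1, 0) ≠ 0 := by
      rcases hne with h | h
      · exact h
      · exact norm_pos_iff.1 ((norm_pos_iff.2 h).trans_le hle)
    obtain ⟨a, ha⟩ := key (1, 0) (-A (0, 1) / A (1, 0), 1) h0 (by
      rw [hAsplit]; field_simp; ring)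
    refine ⟨_, ?_, a, Or.inl ha⟩
    rw [norm_div, norm_neg]
    exact div_le_one_of_le₀ hle (norm_nonneg _)
  · have h0 : A (0, 1) ≠ 0 := by
      rcases hne with h | h
      · exact norm_pos_iff.1 ((norm_pos_iff.2 h).trans_le hle)
      · exact h
    obtain ⟨a, ha⟩ := key (0, 1) (1, -A (1, 0) / A (0, 1)) h0 (by
      rw [hAsplit]; field_simp; ring)
    refine ⟨_, ?_, a, Or.inr ha⟩
    rw [norm_div, norm_neg]
    exact div_le_one_of_le₀ hle (norm_nonneg _)

/-- The conditions on the coefficients of a polynomial of degree at most `8` which vanishes to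
order `9` along the arcs `τ ↦ (a τ² + h τ³, τ)`; here `c k i` is the coefficient of
`x ^ i * y ^ (k - i)`. -/
structure ArcConditions (c : ℕ → ℕ → ℂ) (a : ℂ) : Prop where
  y4 : c 4 0 = 0
  xy3 : c 4 1 = 0
  weight_seven_deriv : c 6 1 + 2 * c 5 2 * a + 3 * c 4 3 * a ^ 2 = 0
  weight_eight : c 8 0 + c 7 1 * a + c 6 2 * a ^ 2 + c 5 3 * a ^ 3 + c 4 4 * a ^ 4 = 0

theorem arcConditions_of_isBigO (c : ℕ → ℕ → ℂ) (a : ℂ)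
    (hc : ∀ h : ℂ, (fun τ => ∑ k ∈ Finset.range 9, ∑ i ∈ Finset.range (k + 1),
      c k i * (a * τ ^ 2 + h * τ ^ 3) ^ i * τ ^ (k - i)) =O[𝓝 0] fun τ => τ ^ 9) :
    ArcConditions c a := by
  have hcoeff : ∀ h : ℂ, ∀ n < 9, ∑ k ∈ Finset.range 9, ∑ i ∈ Finset.range (k + 1),
      c k i * (if k + i ≤ n then
        (i.choose (n - (k + i)) * a ^ (i - (n - (k + i))) * h ^ (n - (k + i)) : ℂ) else 0) = 0 := by
    intro h n hn
    have := Polynomial.coeff_eq_zero_of_eval_isBigO 9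
      (∑ k ∈ Finset.range 9, ∑ i ∈ Finset.range (k + 1), Polynomial.C (c k i) *
        (Polynomial.X ^ (k + i) * (Polynomial.C a + Polynomial.C h * Polynomial.X) ^ i))
      (((hc h).mono nhdsWithin_le_nhds).congr_left fun τ => ?_) n hn
    · simpa only [Polynomial.finsetSum_coeff, Polynomial.coeff_C_mul, Polynomial.coeff_X_pow_mul',
        Polynomial.coeff_C_add_C_mul_X_pow] using this
    · simp only [Polynomial.eval_finsetSum, Polynomial.eval_mul, Polynomial.eval_C,
        Polynomial.eval_pow, Polynomial.eval_X, Polynomial.eval_add]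
      refine Finset.sum_congr rfl fun k _ => Finset.sum_congr rfl fun i hi => ?_
      obtain ⟨j, rfl⟩ := Nat.exists_eq_add_of_le (Finset.mem_range_succ_iff.1 hi)
      rw [show a * τ ^ 2 + h * τ ^ 3 = τ ^ 2 * (a + h * τ) by ring, mul_pow,
        Nat.add_sub_cancel_left]
      ring
  have e4 := hcoeff 0 4 (by norm_num)
  have e5 := fun h => hcoeff h 5 (by norm_num)
  have e6 := fun h => hcoeff h 6 (by norm_num)
  have e7 := fun h => hcoeff h 7 (by norm_num)
  have e8 := fun h => hcoeff h 8 (by norm_num)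
  simp [Finset.sum_range_succ, Nat.choose] at e4 e5 e6 e7 e8
  have h20 : c 2 2 = 0 := by linear_combination (e6 1 + e6 (-1)) / 2 - e6 0
  have h21 : c 3 2 = 0 := by linear_combination (e7 1 + e7 (-1)) / 2 - e7 0
  have h12 : c 3 1 = 0 := by linear_combination e5 1 - e5 0 - 2 * a * h20
  constructor
  · linear_combination e4 - a * h12 - a ^ 2 * h20
  · linear_combination (e6 1 - e6 (-1)) / 2 - 2 * a * h21
  · linear_combination (e8 1 - e8 (-1)) / 2
  · linear_combination e8 0

theorem arcConditions_of_taylor {g : ℂ × ℂ → ℂ}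
    {D : ∀ k : ℕ, ContinuousMultilinearMap ℂ (fun _ : Fin k => ℂ × ℂ) ℂ}
    (hD : (fun p => g p - ∑ k ∈ Finset.range 9, D k (fun _ => p)) =O[𝓝 0] fun p => ‖p‖ ^ 9)
    {v w : ℂ × ℂ} {a : ℂ}
    (hg : ∀ h, (fun τ => g (cubicArc v w a h τ)) =O[𝓝 0] fun τ => τ ^ 9) :
    ArcConditions (fun k i => mixedCoeff (D k) v w i) a := by
  refine arcConditions_of_isBigO _ a fun h => ?_
  have h1 := (hD.comp_tendsto (tendsto_cubicArc v w a h)).trans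
    ((cubicArc_isBigO v w a h).norm_left.pow 9)
  refine ((hg h).sub h1).congr_left fun τ => ?_
  simp only [Function.comp_apply, sub_sub_cancel, cubicArc,
    apply_smul_add_smul_eq_sum_mixedCoeff]

theorem mixedCoeff_eq_coeff {V : Type*} [NormedAddCommGroup V] [NormedSpace ℂ V] {k : ℕ}
    {D : ContinuousMultilinearMap ℂ (fun _ : Fin k => V) ℂ} {v w : V} {q : Polynomial ℂ}
    (h : ∀ x : ℂ, D (fun _ => x • v + w) = q.eval x) {i : ℕ} (hi : i ≤ k) :
    mixedCoeff D v w i = q.coeff i := by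
  have hq : q = ∑ i ∈ Finset.range (k + 1),
      Polynomial.C (mixedCoeff D v w i) * Polynomial.X ^ i := by
    refine Polynomial.funext fun x => ?_
    have := apply_smul_add_smul_eq_sum_mixedCoeff D v w x 1
    rw [one_smul, h] at this
    simpa [Polynomial.eval_finsetSum] using this
  rw [hq]
  simp [Polynomial.finsetSum_coeff, Polynomial.coeff_C_mul, Polynomial.coeff_X_pow,
    Nat.lt_succ_of_le hi]

theorem taylor_Z11 {s t : ℂ} {g : ℂ × ℂ → ℂ}
    (hg : ∀ᶠ p in 𝓝 (0 : ℂ × ℂ),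
      g p = p.1 ^ 3 * p.2 + p.1 ^ 2 * p.2 ^ 3 + s * p.2 ^ 8 + t * p.2 ^ 9)
    {D : ∀ k : ℕ, ContinuousMultilinearMap ℂ (fun _ : Fin k => ℂ × ℂ) ℂ}
    (hD : (fun p => g p - ∑ k ∈ Finset.range 9, D k (fun _ => p)) =O[𝓝 0] fun p => ‖p‖ ^ 9)
    (p : ℂ × ℂ) :
    D 4 (fun _ => p) = p.1 ^ 3 * p.2 ∧ D 5 (fun _ => p) = p.1 ^ 2 * p.2 ^ 3 ∧
      D 6 (fun _ => p) = 0 ∧ D 7 (fun _ => p) = 0 ∧ D 8 (fun _ => p) = s * p.2 ^ 8 := by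
  have hline : Tendsto (fun τ : ℂ => τ • p) (𝓝 0) (𝓝 0) := by
    have : Continuous fun τ : ℂ => τ • p := by fun_prop
    simpa using this.tendsto 0
  have hτ : (fun τ : ℂ => τ • p) =O[𝓝 0] fun τ => τ :=
    isBigO_of_le' (c := ‖p‖) _ fun τ => by rw [norm_smul, mul_comm]
  have h1 := (hD.comp_tendsto hline).trans (hτ.norm_left.pow 9)
  have hcoeff := Polynomial.coeff_eq_zero_of_eval_isBigO 9
    (Polynomial.C (p.1 ^ 3 * p.2) * Polynomial.X ^ 4
      + Polynomial.C (p.1 ^ 2 * p.2 ^ 3) * Polynomial.X ^ 5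
      + Polynomial.C (s * p.2 ^ 8) * Polynomial.X ^ 8
      + Polynomial.C (t * p.2 ^ 9) * Polynomial.X ^ 9
      - ∑ k ∈ Finset.range 9, Polynomial.C (D k (fun _ => p)) * Polynomial.X ^ k)
    ((h1.congr' (by
      filter_upwards [hline.eventually hg] with τ hτ
      have hk : ∀ k, D k (fun _ => τ • p) = D k (fun _ => p) * τ ^ k := fun k => by
        rw [(D k).map_smul_univ (fun _ => τ) (fun _ => p)]; simp [mul_comm]
      simp only [Function.comp_apply, hτ, hk, Polynomial.eval_sub, Polynomial.eval_add,
        Polynomial.eval_finsetSum, Polynomial.eval_mul, Polynomial.eval_C, Polynomial.eval_pow,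
        Polynomial.eval_X, Prod.smul_fst, Prod.smul_snd, smul_eq_mul]
      ring) EventuallyEq.rfl).mono nhdsWithin_le_nhds)
  have e4 := hcoeff 4 (by norm_num)
  have e5 := hcoeff 5 (by norm_num)
  have e6 := hcoeff 6 (by norm_num)
  have e7 := hcoeff 7 (by norm_num)
  have e8 := hcoeff 8 (by norm_num)
  simp only [Polynomial.coeff_sub, Polynomial.coeff_add, Polynomial.coeff_C_mul,
    Polynomial.coeff_X_pow, Polynomial.finsetSum_coeff] at e4 e5 e6 e7 e8
  simp at e4 e5 e6 e7 e8
  exact ⟨(sub_eq_zero.1 e4).symm, (sub_eq_zero.1 e5).symm, e6, e7, (sub_eq_zero.1 e8).symm⟩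

theorem Ultrafilter.exists_tendsto_of_eventually_norm_le {α : Type*} (𝒰 : Ultrafilter α)
    {a : α → ℂ} {R : ℝ} (h : ∀ᶠ u in (𝒰 : Filter α), ‖a u‖ ≤ R) :
    ∃ a₀, Tendsto a 𝒰 (𝓝 a₀) := by
  obtain ⟨a₀, -, h₀⟩ := (isCompact_closedBall (0 : ℂ) R).ultrafilter_le_nhds (𝒰.map a)
    (by
      rw [le_principal_iff, Ultrafilter.coe_map, Filter.mem_map]
      filter_upwards [h] with u hu
      simpa using hu)
  exact ⟨a₀, h₀⟩

theorem exists_ultrafilter_tendsto {α : Type*} {l : Filter α} {S : α → ℂ → Prop}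
    (hS : ∃ᶠ u in l, ∃ q, ‖q‖ ≤ 1 ∧ S u q) :
    ∃ 𝒰 : Ultrafilter α, (𝒰 : Filter α) ≤ l ∧ ∃ (q : α → ℂ) (q₀ : ℂ),
      Tendsto q 𝒰 (𝓝 q₀) ∧ ∀ᶠ u in (𝒰 : Filter α), S u (q u) := by
  have : NeBot (l ⊓ 𝓟 {u | ∃ q, ‖q‖ ≤ 1 ∧ S u q}) := frequently_mem_iff_neBot.1 hS
  have hle := Ultrafilter.of_le (l ⊓ 𝓟 {u | ∃ q, ‖q‖ ≤ 1 ∧ S u q})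
  set 𝒰 := Ultrafilter.of (l ⊓ 𝓟 {u | ∃ q, ‖q‖ ≤ 1 ∧ S u q})
  have hev : ∀ᶠ u in (𝒰 : Filter α), ∃ q, ‖q‖ ≤ 1 ∧ S u q :=
    le_principal_iff.1 (hle.trans inf_le_right)
  obtain ⟨q, hq⟩ := hev.choice
  obtain ⟨q₀, hq₀⟩ := 𝒰.exists_tendsto_of_eventually_norm_le (hq.mono fun _ h => h.1)
  exact ⟨𝒰, hle.trans inf_le_left, q, q₀, hq₀, hq.mono fun _ h => h.2⟩

/-- Arc conditions cannot persist if the coefficients tend to those of `Z_{1,1}`. -/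
theorem not_eventually_arcConditions {α : Type*} {𝒰 : Ultrafilter α} {s : ℂ} (hs : s ≠ 0)
    {c : α → ℕ → ℕ → ℂ} {a : α → ℂ}
    (h43 : Tendsto (fun u => c u 4 3) 𝒰 (𝓝 1)) (h44 : Tendsto (fun u => c u 4 4) 𝒰 (𝓝 0))
    (h52 : Tendsto (fun u => c u 5 2) 𝒰 (𝓝 1)) (h53 : Tendsto (fun u => c u 5 3) 𝒰 (𝓝 0))
    (h61 : Tendsto (fun u => c u 6 1) 𝒰 (𝓝 0)) (h62 : Tendsto (fun u => c u 6 2) 𝒰 (𝓝 0))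
    (h71 : Tendsto (fun u => c u 7 1) 𝒰 (𝓝 0))
    (h80 : Tendsto (fun u => c u 8 0) 𝒰 (𝓝 s)) :
    ¬ ∀ᶠ u in (𝒰 : Filter α), ArcConditions (c u) (a u) := by
  intro hc
  have hbound : ∀ᶠ u in (𝒰 : Filter α), ‖a u‖ ≤ 3 := by
    filter_upwards [hc, h43.norm.eventually (lt_mem_nhds (show 1 / 2 < ‖(1 : ℂ)‖ by norm_num)),
      h52.norm.eventually (gt_mem_nhds (show ‖(1 : ℂ)‖ < 2 by norm_num)),
      h61.norm.eventually (gt_mem_nhds (show ‖(0 : ℂ)‖ < 1 by norm_num))] with u hu h1 h2 h3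
    by_contra! hcon
    have h4 : ‖3 * c u 4 3 * a u ^ 2‖ ≤ ‖2 * c u 5 2 * a u‖ + ‖c u 6 1‖ := by
      have : 3 * c u 4 3 * a u ^ 2 = -(2 * c u 5 2 * a u + c u 6 1) := by
        linear_combination hu.weight_seven_deriv
      rw [this, norm_neg]
      exact norm_add_le _ _
    simp only [norm_mul, norm_pow, Complex.norm_ofNat] at h4
    nlinarith [mul_pos (sub_pos.2 h1) (pow_pos (show 0 < ‖a u‖ by linarith) 2),
      mul_pos (sub_pos.2 h2) (show 0 < ‖a u‖ by linarith)]
  obtain ⟨a₀, ha⟩ := 𝒰.exists_tendsto_of_eventually_norm_le hbound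
  have e8 : s + 0 * a₀ + 0 * a₀ ^ 2 + 0 * a₀ ^ 3 + 0 * a₀ ^ 4 = 0 :=
    tendsto_nhds_unique ((((h80.add (h71.mul ha)).add (h62.mul (ha.pow 2))).add
      (h53.mul (ha.pow 3))).add (h44.mul (ha.pow 4)))
      (tendsto_const_nhds.congr' (hc.mono fun u hu => hu.weight_eight.symm))
  exact hs (by linear_combination e8)

/-- The family Z11 does not deform to `J_{3,0}`: for every analytic deformation
`F` of `f` with parameter in `ℂ^m` (m ≥ 1), all nearby nonzero parameter values
give germs not right equivalent to any member of `J_{3,0}`. -/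
theorem not_deform_to_J30_Z11 (s t : ℂ) (hs : s ≠ 0)
    (m : ℕ) (hm : 1 ≤ m) (F : (ℂ × ℂ) × EuclideanSpace ℂ (Fin m) → ℂ)
    (hF : AnalyticAt ℂ F 0)
    (hF0 : ∀ᶠ p in nhds (0 : ℂ × ℂ), F (p, 0) = p.1 ^ 3 * p.2 + p.1 ^ 2 * p.2 ^ 3 + s * p.2 ^ 8 + t * p.2 ^ 9) :
    ∃ ε > (0 : ℝ), ∀ u : EuclideanSpace ℂ (Fin m), 0 < ‖u‖ → ‖u‖ < ε →
      ∀ b c : ℂ, 4 * b ^ 3 + 27 ≠ 0 →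
        ¬ RightEquiv (fun p => F (p, u)) (J30 b c) := by
  obtain ⟨D, hDcont, hD⟩ := exists_taylor_family F hF 9
  have hZ := taylor_Z11 hF0 hD.self_of_nhds
  suffices h : ∀ᶠ u in 𝓝 (0 : EuclideanSpace ℂ (Fin m)), ∀ b c : ℂ,
      ¬ RightEquiv (fun p => F (p, u)) (J30 b c) by
    obtain ⟨ε, hε, h⟩ := Metric.eventually_nhds_iff.1 h
    exact ⟨ε, hε, fun u _ hu b c _ => h (by simpa using hu) b c⟩
  by_contra hcon
  have hfreq : ∃ᶠ u in 𝓝 (0 : EuclideanSpace ℂ (Fin m)),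
      (∃ q : ℂ, ‖q‖ ≤ 1 ∧ ∃ a,
        ArcConditions (fun k i => mixedCoeff (D k u) (1, 0) (q, 1) i) a) ∨
      (∃ q : ℂ, ‖q‖ ≤ 1 ∧ ∃ a,
        ArcConditions (fun k i => mixedCoeff (D k u) (0, 1) (1, q) i) a) := by
    refine ((not_eventually.1 hcon).and_eventually hD).mono fun u ⟨hu, hDu⟩ => ?_
    push Not at hu
    obtain ⟨b, c, hbc⟩ := hu
    obtain ⟨q, hq, a, ha | ha⟩ := hbc.exists_cubicArc
    · exact Or.inl ⟨q, hq, a, arcConditions_of_taylor hDu ha⟩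
    · exact Or.inr ⟨q, hq, a, arcConditions_of_taylor hDu ha⟩
  rcases frequently_or_distrib.1 hfreq with h | h
  · obtain ⟨𝒰, hle, q, q₀, hq, hc⟩ := exists_ultrafilter_tendsto h
    have hlim : ∀ k i, Tendsto (fun u => mixedCoeff (D k u) (1, 0) (q u, 1) i) 𝒰
        (𝓝 (mixedCoeff (D k 0) (1, 0) (q₀, 1) i)) := fun k i =>
      ((hDcont k).tendsto.mono_left hle).mixedCoeff tendsto_const_nhds
        (hq.prodMk_nhds tendsto_const_nhds) i
    obtain ⟨a, ha⟩ := hc.choice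
    have hq0 : q₀ = 0 := by
      have h1 : mixedCoeff (D 4 0) (1, 0) (q₀, 1) 0 = 0 :=
        tendsto_nhds_unique (hlim 4 0)
          (tendsto_const_nhds.congr' (ha.mono fun u hu => hu.y4.symm))
      rw [mixedCoeff_eq_coeff (q := (Polynomial.X + Polynomial.C q₀) ^ 3)
        (fun x => by simp [(hZ _).1]) (by norm_num), Polynomial.coeff_X_add_C_pow] at h1
      simpa using h1
    subst hq0
    have m4 : ∀ i ≤ 4, mixedCoeff (D 4 0) (1, 0) (0, 1) i = (Polynomial.X ^ 3).coeff i :=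
      fun i hi => mixedCoeff_eq_coeff (fun x => by simp [(hZ _).1]) hi
    have m5 : ∀ i ≤ 5, mixedCoeff (D 5 0) (1, 0) (0, 1) i = (Polynomial.X ^ 2).coeff i :=
      fun i hi => mixedCoeff_eq_coeff (fun x => by simp [(hZ _).2.1]) hi
    have m6 : ∀ i ≤ 6, mixedCoeff (D 6 0) (1, 0) (0, 1) i = (0 : Polynomial ℂ).coeff i :=
      fun i hi => mixedCoeff_eq_coeff (fun x => by simp [(hZ _).2.2.1]) hi
    have m7 : ∀ i ≤ 7, mixedCoeff (D 7 0) (1, 0) (0, 1) i = (0 : Polynomial ℂ).coeff i :=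
      fun i hi => mixedCoeff_eq_coeff (fun x => by simp [(hZ _).2.2.2.1]) hi
    have m8 : ∀ i ≤ 8, mixedCoeff (D 8 0) (1, 0) (0, 1) i = (Polynomial.C s).coeff i :=
      fun i hi => mixedCoeff_eq_coeff (fun x => by simp [(hZ _).2.2.2.2]) hi
    refine not_eventually_arcConditions hs ?_ ?_ ?_ ?_ ?_ ?_ ?_ ?_ ha
    · simpa [m4, Polynomial.coeff_X_pow] using hlim 4 3
    · simpa [m4, Polynomial.coeff_X_pow] using hlim 4 4
    · simpa [m5, Polynomial.coeff_X_pow] using hlim 5 2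
    · simpa [m5, Polynomial.coeff_X_pow] using hlim 5 3
    · simpa [m6] using hlim 6 1
    · simpa [m6] using hlim 6 2
    · simpa [m7] using hlim 7 1
    · simpa [m8] using hlim 8 0
  · obtain ⟨𝒰, hle, q, q₀, hq, hc⟩ := exists_ultrafilter_tendsto h
    have hlim : Tendsto (fun u => mixedCoeff (D 4 u) (0, 1) (1, q u) 1) 𝒰
        (𝓝 (mixedCoeff (D 4 0) (0, 1) (1, q₀) 1)) :=
      ((hDcont 4).tendsto.mono_left hle).mixedCoeff tendsto_const_nhds
        (tendsto_const_nhds.prodMk_nhds hq) 1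
    have h1 : mixedCoeff (D 4 0) (0, 1) (1, q₀) 1 = 0 :=
      tendsto_nhds_unique hlim
        (tendsto_const_nhds.congr' (hc.mono fun u ⟨_, hu⟩ => hu.xy3.symm))
    rw [mixedCoeff_eq_coeff (q := Polynomial.X + Polynomial.C q₀)
      (fun x => by simp [(hZ _).1]) (by norm_num)] at h1
    simp at h1
end

section
/- Let s, t ∈ ℂ with s ≠ 0 and let f(x,y) = x⁴ + x²y³ + s y⁸ + t y⁹ (the family W_{1,2}). Then f does not deform to J_{3,0}: for every integer m ≥ 1 and every function F(x,y,u), analytic on a neighborhood of 0 in ℂ² × ℂ^m, with F(x,y,0) = f(x,y), there exists ε > 0 such that for every u ∈ ℂ^m with 0 < ‖u‖ < ε, the germ at 0 of (x,y) ↦ F(x,y,u) is not right equivalent to the germ at 0 of x³ + b x²y³ + y⁹ + c x y⁷ for any b, c ∈ ℂ with 4b³ + 27 ≠ 0. -/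
open Filter

open Topology Asymptotics
/-- The polynomial of degree less than `N` in two variables in which
`x ^ i * y ^ (d - i)` has coefficient `a d i`. -/
noncomputable def jet (N : ℕ) (a : ℕ → ℕ → ℂ) (p : ℂ × ℂ) : ℂ :=
  ∑ d ∈ Finset.range N, ∑ i ∈ Finset.range (d + 1), a d i * (p.1 ^ i * p.2 ^ (d - i))

theorem multilinear_diag {V : Type*} [NormedAddCommGroup V] [NormedSpace ℂ V] {d : ℕ}
    (q : V [×d]→L[ℂ] ℂ) (e₁ e₂ : V) (x y : ℂ) :
    q (fun _ => x • e₁ + y • e₂) =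
      ∑ i ∈ Finset.range (d + 1),
        (∑ s : Finset (Fin d) with s.card = i, q (s.piecewise (fun _ => e₁) (fun _ => e₂))) *
          (x ^ i * y ^ (d - i)) := by
  have h1 : q (fun _ => x • e₁ + y • e₂) =
      ∑ s : Finset (Fin d), q (s.piecewise (fun _ => e₁) (fun _ => e₂)) *
          (x ^ s.card * y ^ (d - s.card)) := by
    rw [show (fun _ : Fin d => x • e₁ + y • e₂) = (fun _ => x • e₁) + (fun _ => y • e₂) from rfl,
      q.map_add_univ]
    refine Finset.sum_congr rfl fun s _ => ?_
    have : s.piecewise (fun _ : Fin d => x • e₁) (fun _ => y • e₂) = fun i =>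
        (s.piecewise (fun _ => x) (fun _ => y) : Fin d → ℂ) i •
          (s.piecewise (fun _ => e₁) (fun _ => e₂) : Fin d → V) i := by
      ext i
      by_cases hi : i ∈ s <;> simp [hi]
    rw [this, q.map_smul_univ, Finset.prod_piecewise, smul_eq_mul, mul_comm]
    simp [Finset.card_sdiff]
  rw [h1, ← Finset.sum_fiberwise_of_maps_to (t := Finset.range (d + 1))
    (g := fun s : Finset (Fin d) => s.card)]
  · refine Finset.sum_congr rfl fun i _ => ?_
    rw [Finset.sum_mul]
    refine Finset.sum_congr rfl fun s hs => ?_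
    rw [(Finset.mem_filter.1 hs).2]
  · intro s _
    simpa [Nat.lt_succ_iff] using s.card_le_univ

/-- The Taylor coefficients in `(x, y)` of an analytic function of `(x, y)` and a parameter `u`
depend continuously on `u`. -/
theorem exists_jet_expansion {E : Type*} [NormedAddCommGroup E] [NormedSpace ℂ E]
    {F : (ℂ × ℂ) × E → ℂ} (hF : AnalyticAt ℂ F 0) :
    ∃ a : E → ℕ → ℕ → ℂ, (∀ d i, ContinuousAt (fun u => a u d i) 0) ∧
      ∀ᶠ u in 𝓝 (0 : E), ∀ N, (fun p => F (p, u) - jet N (a u) p) =O[𝓝 0] fun p => ‖p‖ ^ N := by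
  obtain ⟨q, r, hq⟩ := hF
  refine ⟨fun u d i => ∑ s : Finset (Fin d) with s.card = i,
    q.changeOrigin (((0, 0), u) : (ℂ × ℂ) × E) d
      (s.piecewise (fun _ => ((1, 0), 0)) (fun _ => ((0, 1), 0))), ?_, ?_⟩
  · intro d i
    have hc : ContinuousAt (fun u : E => q.changeOrigin (((0, 0), u) : (ℂ × ℂ) × E) d) 0 := by
      have h := (q.analyticAt_changeOrigin (hq.r_pos.trans_le hq.r_le) d).continuousAt
      refine ContinuousAt.comp (f := fun u : E => (((0, 0), u) : (ℂ × ℂ) × E))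
        (g := fun z => q.changeOrigin z d) h (by fun_prop)
    refine tendsto_finsetSum _ fun s _ => ?_
    exact ((ContinuousMultilinearMap.apply ℂ (fun _ : Fin d => (ℂ × ℂ) × E) ℂ
      (s.piecewise (fun _ => ((1, 0), 0)) (fun _ => ((0, 1), 0)))).continuous.continuousAt.comp hc)
  · have hu : ∀ᶠ u in 𝓝 (0 : E), (‖(((0, 0), u) : (ℂ × ℂ) × E)‖₊ : ENNReal) < r := by
      have : ContinuousAt (fun u : E => (‖(((0, 0), u) : (ℂ × ℂ) × E)‖₊ : ENNReal)) 0 := by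
        fun_prop
      refine this.eventually_lt continuousAt_const ?_
      simpa [Prod.nnnorm_def] using hq.r_pos
    filter_upwards [hu] with u hu N
    have h := (hq.changeOrigin hu).hasFPowerSeriesAt.isBigO_sub_partialSum_pow N
    have ht : Tendsto (fun p : ℂ × ℂ => ((p, 0) : (ℂ × ℂ) × E)) (𝓝 0) (𝓝 0) :=
      Continuous.tendsto' (by fun_prop) _ _ rfl
    refine (h.comp_tendsto ht).congr (fun p => ?_) (fun p => ?_)
    · have hp : ((p, 0) : (ℂ × ℂ) × E) = p.1 • ((1, 0), 0) + p.2 • ((0, 1), 0) := by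
        ext <;> simp
      simp only [Function.comp, FormalMultilinearSeries.partialSum, jet]
      congr 1
      · congr 1; ext <;> simp
      · refine Finset.sum_congr rfl fun d _ => ?_
        rw [hp, multilinear_diag]
    · simp [Prod.norm_def]

theorem isBigO_pow_of_le {m n : ℕ} (h : m ≤ n) :
    (fun τ : ℂ => τ ^ n) =O[𝓝 0] fun τ => τ ^ m := by
  rcases h.eq_or_lt with rfl | h
  · exact isBigO_refl _ _
  · exact (isLittleO_pow_pow h).isBigO

theorem coeff_eq_zero_of_isBigO {n : ℕ} {P : Polynomial ℂ}
    (h : (fun τ => P.eval τ) =O[𝓝 0] fun τ : ℂ => τ ^ n) {k : ℕ} (hk : k < n) :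
    P.coeff k = 0 := by
  induction k using Nat.strong_induction_on with
  | _ k ih =>
    obtain ⟨Q, rfl⟩ := Polynomial.X_pow_dvd_iff.2 fun d hd => ih d hd (hd.trans hk)
    rw [Polynomial.coeff_X_pow_mul', if_pos le_rfl, Nat.sub_self,
      Polynomial.coeff_zero_eq_eval_zero]
    have h1 : (fun τ : ℂ => τ ^ k * Q.eval τ) =O[𝓝[≠] 0] fun τ => τ ^ k * τ := by
      refine ((h.trans (isBigO_pow_of_le hk)).mono nhdsWithin_le_nhds).congr (fun τ => ?_)
        fun τ => pow_succ τ k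
      simp
    have h2 : (fun τ : ℂ => Q.eval τ) =O[𝓝[≠] 0] fun τ => τ := by
      have h0 : ∀ᶠ τ : ℂ in 𝓝[≠] 0, τ ≠ 0 := eventually_mem_nhdsWithin
      have := (isBigO_refl (fun τ : ℂ => (τ ^ k)⁻¹) (𝓝[≠] 0)).mul h1
      refine this.congr' ?_ ?_ <;>
      · filter_upwards [h0] with τ hτ
        field_simp
    exact tendsto_nhds_unique (Q.continuous.continuousAt.tendsto.mono_left nhdsWithin_le_nhds)
      (h2.trans_tendsto (tendsto_id.mono_left nhdsWithin_le_nhds))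

/-- The restriction of `jet N a` to the polynomial curve `(A, B)`. -/
noncomputable def jetAlong (N : ℕ) (a : ℕ → ℕ → ℂ) (A B : Polynomial ℂ) : Polynomial ℂ :=
  ∑ d ∈ Finset.range N, ∑ i ∈ Finset.range (d + 1), Polynomial.C (a d i) * (A ^ i * B ^ (d - i))

theorem eval_jetAlong (N : ℕ) (a : ℕ → ℕ → ℂ) (A B : Polynomial ℂ) (τ : ℂ) :
    (jetAlong N a A B).eval τ = jet N a (A.eval τ, B.eval τ) := by
  simp [jetAlong, jet, Polynomial.eval_finsetSum]

theorem isBigO_eval_of_dvd {A : Polynomial ℂ} {n : ℕ} (hA : Polynomial.X ^ n ∣ A) :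
    (fun τ => A.eval τ) =O[𝓝 0] fun τ : ℂ => τ ^ n := by
  obtain ⟨Q, rfl⟩ := hA
  have := (isBigO_refl (fun τ : ℂ => τ ^ n) (𝓝 0)).mul
    ((Q.continuous.continuousAt (x := 0)).isBigO_one ℂ)
  simpa using this

theorem isBigO_sub_jetAlong {g : ℂ × ℂ → ℂ} {N : ℕ} {a : ℕ → ℕ → ℂ}
    (hg : (fun p => g p - jet N a p) =O[𝓝 0] fun p => ‖p‖ ^ N) {A B : Polynomial ℂ}
    (hA : Polynomial.X ∣ A) (hB : Polynomial.X ∣ B) :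
    (fun τ => g (A.eval τ, B.eval τ) - (jetAlong N a A B).eval τ) =O[𝓝 0]
      fun τ : ℂ => τ ^ N := by
  have hA' := isBigO_eval_of_dvd (n := 1) (by simpa using hA)
  have hB' := isBigO_eval_of_dvd (n := 1) (by simpa using hB)
  have hAB : (fun τ => (A.eval τ, B.eval τ)) =O[𝓝 0] fun τ : ℂ => τ := by
    simpa using hA'.prod_left hB'
  have ht : Tendsto (fun τ => (A.eval τ, B.eval τ)) (𝓝 0) (𝓝 (0 : ℂ × ℂ)) :=
    hAB.trans_tendsto tendsto_id
  simp only [eval_jetAlong]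
  exact (hg.comp_tendsto ht).trans (hAB.norm_left.pow N)

theorem coeff_jetAlong_eq_zero {g : ℂ × ℂ → ℂ} {N M : ℕ} {a : ℕ → ℕ → ℂ}
    (hg : (fun p => g p - jet N a p) =O[𝓝 0] fun p => ‖p‖ ^ N) {A B : Polynomial ℂ}
    (hA : Polynomial.X ∣ A) (hB : Polynomial.X ∣ B) (hM : M ≤ N)
    (h : (fun τ => g (A.eval τ, B.eval τ)) =O[𝓝 0] fun τ : ℂ => τ ^ M) {k : ℕ} (hk : k < M) :
    (jetAlong N a A B).coeff k = 0 := by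
  refine coeff_eq_zero_of_isBigO ?_ hk
  have := h.sub ((isBigO_sub_jetAlong hg hA hB).trans (isBigO_pow_of_le hM))
  simpa using this

theorem coeff_jetAlong_line (N : ℕ) (a : ℕ → ℕ → ℂ) (v w : ℂ) {k : ℕ} (hk : k < N) :
    (jetAlong N a (Polynomial.C v * Polynomial.X) (Polynomial.C w * Polynomial.X)).coeff k =
      ∑ i ∈ Finset.range (k + 1), a k i * (v ^ i * w ^ (k - i)) := by
  have h : jetAlong N a (Polynomial.C v * Polynomial.X) (Polynomial.C w * Polynomial.X) =
      ∑ d ∈ Finset.range N, Polynomial.C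
        (∑ i ∈ Finset.range (d + 1), a d i * (v ^ i * w ^ (d - i))) * Polynomial.X ^ d := by
    refine Finset.sum_congr rfl fun d _ => ?_
    rw [map_sum, Finset.sum_mul]
    refine Finset.sum_congr rfl fun i hi => ?_
    obtain ⟨j, rfl⟩ := Nat.exists_eq_add_of_le (Nat.lt_succ_iff.1 (Finset.mem_range.1 hi))
    simp only [Nat.add_sub_cancel_left, map_mul, map_pow]
    ring
  rw [h, Polynomial.finsetSum_coeff]
  simp only [Polynomial.coeff_C_mul, Polynomial.coeff_X_pow]
  simp [hk]

theorem coeff_linear_pow (b c : ℂ) (i k : ℕ) :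
    ((Polynomial.C b + Polynomial.C c * Polynomial.X) ^ i).coeff k =
      i.choose k * b ^ (i - k) * c ^ k := by
  have h : (Polynomial.C b + Polynomial.C c * Polynomial.X) ^ i =
      ((Polynomial.X + Polynomial.C b) ^ i).comp (Polynomial.C c * Polynomial.X) := by
    simp [add_comm]
  rw [h, Polynomial.comp_C_mul_X_coeff, Polynomial.coeff_X_add_C_pow]
  ring

/-- The coefficient of `c ^ k` in the coefficient of `τ ^ n` of a power series with coefficients
`a` restricted to the curve `(b τ + c τ ^ 2, τ)`. -/
noncomputable def parabolaCoeff (a : ℕ → ℕ → ℂ) (b : ℂ) (n k : ℕ) : ℂ :=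
  ∑ i ∈ Finset.range (n - k + 1), a (n - k) i * (i.choose k * b ^ (i - k))

theorem coeff_jetAlong_parabola (N : ℕ) (a : ℕ → ℕ → ℂ) (b c : ℂ) {n : ℕ} (hn : n < N) :
    (jetAlong N a (Polynomial.X * (Polynomial.C b + Polynomial.C c * Polynomial.X))
      Polynomial.X).coeff n = ∑ k ∈ Finset.range (n + 1), parabolaCoeff a b n k * c ^ k := by
  have h : jetAlong N a (Polynomial.X * (Polynomial.C b + Polynomial.C c * Polynomial.X))
      Polynomial.X = ∑ d ∈ Finset.range N, Polynomial.X ^ d * ∑ i ∈ Finset.range (d + 1),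
        Polynomial.C (a d i) * (Polynomial.C b + Polynomial.C c * Polynomial.X) ^ i := by
    refine Finset.sum_congr rfl fun d _ => ?_
    rw [Finset.mul_sum]
    refine Finset.sum_congr rfl fun i hi => ?_
    obtain ⟨j, rfl⟩ := Nat.exists_eq_add_of_le (Nat.lt_succ_iff.1 (Finset.mem_range.1 hi))
    rw [Nat.add_sub_cancel_left, mul_pow]
    ring
  rw [h, Polynomial.finsetSum_coeff, ← Finset.sum_flip (fun k => parabolaCoeff a b n k * c ^ k),
    ← Finset.sum_subset (Finset.range_subset_range.2 (Nat.succ_le_of_lt hn))]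
  · refine Finset.sum_congr rfl fun d hd => ?_
    have hd' : d ≤ n := Nat.lt_succ_iff.1 (Finset.mem_range.1 hd)
    rw [Polynomial.coeff_X_pow_mul', if_pos hd', Polynomial.finsetSum_coeff, parabolaCoeff,
      Nat.sub_sub_self hd', Finset.sum_mul]
    refine Finset.sum_congr rfl fun i _ => ?_
    rw [Polynomial.coeff_C_mul, coeff_linear_pow]
    ring
  · intro d _ hd
    rw [Polynomial.coeff_X_pow_mul', if_neg]
    simpa using hd

theorem isBigO_J30_comp {X Y : ℂ → ℂ} {k n : ℕ} (hX : X =O[𝓝 0] fun τ => τ ^ k)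
    (hY : Y =O[𝓝 0] fun τ => τ) (β γ : ℂ) (h₁ : n ≤ 3 * k) (h₂ : n ≤ 2 * k + 3) (h₃ : n ≤ 9)
    (h₄ : n ≤ k + 7) :
    (fun τ => J30 β γ (X τ, Y τ)) =O[𝓝 0] fun τ => τ ^ n := by
  have key : ∀ {i j : ℕ}, n ≤ i * k + j →
      (fun τ => X τ ^ i * Y τ ^ j) =O[𝓝 0] fun τ => τ ^ n := fun {i j} hij =>
    ((hX.pow i).mul (hY.pow j)).trans
      (by simpa [← pow_mul, ← pow_add, mul_comm k i] using isBigO_pow_of_le hij)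
  have H := (((key (i := 3) (j := 0) (by omega)).add
    ((key (i := 2) (j := 3) (by omega)).const_mul_left β)).add
    (key (i := 0) (j := 9) (by omega))).add
    ((key (i := 1) (j := 7) (by omega)).const_mul_left γ)
  refine H.congr_left fun τ => ?_
  simp only [J30]
  ring

/-- A germ in `J_{3,0}` vanishes to order `6` along the line and to order `9` along the parabola
osculating the first coordinate curve of its normal form. -/
theorem RightEquiv.exists_curve {g : ℂ × ℂ → ℂ} {β γ : ℂ} (h : RightEquiv g (J30 β γ))
    {a : ℕ → ℕ → ℂ} (hg : (fun p => g p - jet 9 a p) =O[𝓝 0] fun p => ‖p‖ ^ 9)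
    (ha : a 4 4 ≠ 0) :
    ∃ b c : ℂ, ∑ i ∈ Finset.range 5, a 4 i * b ^ i = 0 ∧
      ∑ k ∈ Finset.range 8, parabolaCoeff a b 7 k * c ^ k = 0 ∧
      ∑ k ∈ Finset.range 9, parabolaCoeff a b 8 k * c ^ k = 0 := by
  obtain ⟨φ, hφ0, hφ, ⟨L, hL⟩, hgφ⟩ := h
  have hφd := hφ.differentiableAt.hasFDerivAt
  have hφO : φ =O[𝓝 0] fun p => p := by simpa [hφ0] using hφd.isBigO_sub
  have hφ1 : AnalyticAt ℂ (fun z : (ℂ × ℂ) × ℂ => (φ z.1).1) 0 :=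
    analyticAt_fst.comp (AnalyticAt.comp (g := φ) (f := Prod.fst) hφ analyticAt_fst)
  obtain ⟨e', -, he'⟩ := exists_jet_expansion hφ1
  obtain ⟨e, he⟩ : ∃ e, (fun p => (φ p).1 - jet 3 e p) =O[𝓝 0] fun p => ‖p‖ ^ 3 :=
    ⟨e' 0, he'.self_of_nhds 3⟩
  have hcurve : ∀ {A B : Polynomial ℂ}, Polynomial.X ∣ A → Polynomial.X ∣ B →
      (fun τ => (A.eval τ, B.eval τ)) =O[𝓝 0] fun τ : ℂ => τ := fun hA hB => by
    simpa using (isBigO_eval_of_dvd (n := 1) (by simpa using hA)).prod_left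
      (isBigO_eval_of_dvd (n := 1) (by simpa using hB))
  have hφcurve : ∀ {A B : Polynomial ℂ}, Polynomial.X ∣ A → Polynomial.X ∣ B →
      (fun τ => φ (A.eval τ, B.eval τ)) =O[𝓝 0] fun τ : ℂ => τ := fun hA hB =>
    (hφO.comp_tendsto ((hcurve hA hB).trans_tendsto tendsto_id)).trans (hcurve hA hB)
  have hφ1curve : ∀ {A B : Polynomial ℂ} {n : ℕ}, Polynomial.X ∣ A → Polynomial.X ∣ B → n ≤ 3 →
      (∀ k < n, (jetAlong 3 e A B).coeff k = 0) →
      (fun τ => (φ (A.eval τ, B.eval τ)).1) =O[𝓝 0] fun τ : ℂ => τ ^ n := fun hA hB hn hk => by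
    simpa using ((isBigO_sub_jetAlong he hA hB).trans (isBigO_pow_of_le hn)).add
      (isBigO_eval_of_dvd (Polynomial.X_pow_dvd_iff.2 hk))
  have hgcurve : ∀ {A B : Polynomial ℂ} {k n : ℕ}, Polynomial.X ∣ A → Polynomial.X ∣ B →
      (∀ j < k, (jetAlong 3 e A B).coeff j = 0) → k ≤ 3 → n ≤ 3 * k → n ≤ 2 * k + 3 →
      n ≤ 9 → n ≤ k + 7 → ∀ j < n, (jetAlong 9 a A B).coeff j = 0 := by
    intro A B k n hA hB hk hk3 h₁ h₂ h₃ h₄ j hj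
    refine coeff_jetAlong_eq_zero hg hA hB h₃ ?_ hj
    refine (isBigO_J30_comp (hφ1curve hA hB hk3 hk)
      (isBigO_snd_prod'.trans (hφcurve hA hB)) β γ h₁ h₂ h₃ h₄).congr' ?_ EventuallyEq.rfl
    filter_upwards [((hcurve hA hB).trans_tendsto tendsto_id).eventually hgφ] with τ hτ
    exact hτ.symm
  have hline : ∀ v : ℂ, Polynomial.X ∣ Polynomial.C v * Polynomial.X := fun v =>
    dvd_mul_left _ _
  have he00 : e 0 0 = 0 := by
    have := coeff_jetAlong_eq_zero he (hline 0) (hline 0) (M := 1) (by norm_num)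
      (by simpa using isBigO_fst_prod'.trans (hφcurve (hline 0) (hline 0))) zero_lt_one
    rw [coeff_jetAlong_line 3 e _ _ (by norm_num)] at this
    simpa using this
  have hlinear : ∀ v w : ℂ, e 1 0 * w + e 1 1 * v = 0 → ∀ k < 2, (jetAlong 3 e
      (Polynomial.C v * Polynomial.X) (Polynomial.C w * Polynomial.X)).coeff k = 0 := by
    intro v w hvw k hk
    rw [coeff_jetAlong_line 3 e v w (by omega)]
    interval_cases k
    · simp [he00]
    · simpa [Finset.sum_range_succ] using hvw
  have hne : e 1 1 ≠ 0 ∨ e 1 0 ≠ 0 := by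
    by_contra! hcon
    obtain ⟨⟨v, w⟩, hvw⟩ := L.surjective (1, 0)
    have h1 := hφ1curve (n := 2) (hline v) (hline w) (by norm_num)
      (hlinear v w (by simp [hcon.1, hcon.2]))
    have h2 : HasDerivAt (fun τ : ℂ => (φ ((Polynomial.C v * Polynomial.X).eval τ,
        (Polynomial.C w * Polynomial.X).eval τ)).1) 1 0 := by
      have hl : HasDerivAt (fun τ : ℂ => ((Polynomial.C v * Polynomial.X).eval τ,
          (Polynomial.C w * Polynomial.X).eval τ)) (v, w) 0 := by
        simpa using ((hasDerivAt_id (0 : ℂ)).const_mul v).prodMk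
          ((hasDerivAt_id (0 : ℂ)).const_mul w)
      have hφd' : HasFDerivAt φ (L : (ℂ × ℂ) →L[ℂ] ℂ × ℂ) ((Polynomial.C v * Polynomial.X).eval 0,
          (Polynomial.C w * Polynomial.X).eval 0) := by
        rw [← hL, Polynomial.eval_mul, Polynomial.eval_mul, Polynomial.eval_X, mul_zero, mul_zero]
        exact hφd
      have h := (hasFDerivAt_fst (𝕜 := ℂ) (p := φ _)).comp_hasDerivAt (0 : ℂ)
        (hφd'.comp_hasDerivAt (0 : ℂ) hl)
      have h1 : ContinuousLinearMap.fst ℂ ℂ ℂ ((L : (ℂ × ℂ) →L[ℂ] ℂ × ℂ) (v, w)) = 1 := by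
        simp [hvw]
      rw [h1] at h
      exact h
    have h3 : HasDerivAt (fun τ : ℂ => (φ ((Polynomial.C v * Polynomial.X).eval τ,
        (Polynomial.C w * Polynomial.X).eval τ)).1) 0 0 := by
      have h4 := IsBigO.hasFDerivAt (𝕜 := ℂ) (x₀ := (0 : ℂ)) (n := 2)
        (h1.norm_right.congr_right fun τ => by simp) one_lt_two
      simpa using h4.hasDerivAt
    exact one_ne_zero (h2.unique h3)
  have hquartic : ∑ i ∈ Finset.range 5, a 4 i * ((e 1 0) ^ i * (-e 1 1) ^ (4 - i)) = 0 := by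
    rw [← coeff_jetAlong_line 9 a _ _ (by norm_num)]
    exact hgcurve (k := 2) (n := 6) (hline _) (hline _) (hlinear _ _ (by ring)) (by norm_num)
      (by norm_num) (by norm_num) (by norm_num) (by norm_num) 4 (by norm_num)
  have he11 : e 1 1 ≠ 0 := by
    intro h0
    have h10 : e 1 0 ≠ 0 := by simpa [h0] using hne
    simp [h0, Finset.sum_range_succ, ha, h10] at hquartic
  refine ⟨-e 1 0 / e 1 1, -(e 2 0 + e 2 1 * (-e 1 0 / e 1 1) + e 2 2 * (-e 1 0 / e 1 1) ^ 2) /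
    e 1 1, ?_, ?_⟩
  · simp only [Finset.sum_range_succ, Finset.sum_range_zero] at hquartic ⊢
    field_simp
    linear_combination hquartic
  · set b := -e 1 0 / e 1 1 with hb
    set c := -(e 2 0 + e 2 1 * b + e 2 2 * b ^ 2) / e 1 1 with hc
    have hb' : e 1 1 * b = -e 1 0 := by rw [hb]; field_simp
    have hc' : e 1 1 * c = -(e 2 0 + e 2 1 * b + e 2 2 * b ^ 2) := by rw [hc]; field_simp
    have hpar := hgcurve (k := 3) (n := 9) (B := Polynomial.X)
      (A := Polynomial.X * (Polynomial.C b + Polynomial.C c * Polynomial.X))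
      (dvd_mul_right _ _) dvd_rfl
      (fun j hj => by
        rw [coeff_jetAlong_parabola 3 e b c hj]
        interval_cases j
        · simp [parabolaCoeff, he00]
        · simp [parabolaCoeff, Finset.sum_range_succ]
          linear_combination hb'
        · simp [parabolaCoeff, Finset.sum_range_succ]
          linear_combination hc')
      (by norm_num) (by norm_num) (by norm_num) (by norm_num) (by norm_num)
    have h7 := hpar 7 (by norm_num)
    have h8 := hpar 8 (by norm_num)
    rw [coeff_jetAlong_parabola 9 a b c (by norm_num)] at h7 h8
    exact ⟨h7, h8⟩

theorem jet_coeff_unique {g : ℂ × ℂ → ℂ} {N : ℕ} {a a' : ℕ → ℕ → ℂ}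
    (h : (fun p => g p - jet N a p) =O[𝓝 0] fun p => ‖p‖ ^ N)
    (h' : (fun p => g p - jet N a' p) =O[𝓝 0] fun p => ‖p‖ ^ N) {d i : ℕ} (hd : d < N)
    (hi : i ≤ d) : a d i = a' d i := by
  have key : ∑ i ∈ Finset.range (d + 1), Polynomial.C (a d i) * Polynomial.X ^ i =
      ∑ i ∈ Finset.range (d + 1), Polynomial.C (a' d i) * Polynomial.X ^ i := by
    refine Polynomial.funext fun v => ?_
    have hv : Polynomial.X ∣ Polynomial.C v * Polynomial.X := dvd_mul_left _ _
    have h1 : Polynomial.X ∣ Polynomial.C (1 : ℂ) * Polynomial.X := dvd_mul_left _ _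
    have h0 := coeff_eq_zero_of_isBigO (P :=
      jetAlong N a (Polynomial.C v * Polynomial.X) (Polynomial.C 1 * Polynomial.X) -
        jetAlong N a' (Polynomial.C v * Polynomial.X) (Polynomial.C 1 * Polynomial.X))
      (((isBigO_sub_jetAlong h' hv h1).sub (isBigO_sub_jetAlong h hv h1)).congr_left
        fun τ => by simp) hd
    rw [Polynomial.coeff_sub, coeff_jetAlong_line N a _ _ hd, coeff_jetAlong_line N a' _ _ hd,
      sub_eq_zero] at h0
    simpa [Polynomial.eval_finsetSum] using h0
  have := congrArg (fun P => Polynomial.coeff P i) key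
  simpa [Polynomial.finsetSum_coeff, Polynomial.coeff_X_pow, Nat.lt_succ_iff, hi] using this

/-- The coefficients of `x ^ 4 + x ^ 2 * y ^ 3 + s * y ^ 8`, indexed by the degree and by the
exponent of `x`. -/
noncomputable def w12Coeff (s : ℂ) : ℕ → ℕ → ℂ
  | 4, 4 => 1
  | 5, 2 => 1
  | 8, 0 => s
  | _, _ => 0

theorem isBigO_sub_jet_w12Coeff (s t : ℂ) :
    (fun p : ℂ × ℂ => p.1 ^ 4 + p.1 ^ 2 * p.2 ^ 3 + s * p.2 ^ 8 + t * p.2 ^ 9 -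
      jet 9 (w12Coeff s) p) =O[𝓝 0] fun p => ‖p‖ ^ 9 := by
  have h : (fun p : ℂ × ℂ => t * p.2 ^ 9) =O[𝓝 0] fun p => ‖p‖ ^ 9 :=
    (isBigO_snd_prod'.norm_right.pow 9).const_mul_left t
  refine h.congr_left fun p => ?_
  simp [jet, Finset.sum_range_succ, w12Coeff]

theorem parabolaCoeff_eq_zero (a : ℕ → ℕ → ℂ) (b : ℂ) {n k : ℕ} (h : n < 2 * k) :
    parabolaCoeff a b n k = 0 := by
  refine Finset.sum_eq_zero fun i hi => ?_
  rw [Nat.choose_eq_zero_of_lt (by have := Finset.mem_range.1 hi; omega)]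
  simp

theorem isBigO_one_of_root {ι : Type*} {l : Filter ι} {n : ℕ} {A : ι → ℕ → ℂ} {α : ℕ → ℂ}
    (hA : ∀ k < n + 2, Tendsto (fun u => A u k) l (𝓝 (α k))) (hα : α (n + 1) ≠ 0) {z : ι → ℂ}
    (hz : ∀ᶠ u in l, ∑ k ∈ Finset.range (n + 2), A u k * z u ^ k = 0) :
    z =O[l] fun _ => (1 : ℂ) := by
  have hlead : ∀ᶠ u in l, ‖α (n + 1)‖ / 2 < ‖A u (n + 1)‖ :=
    (hA (n + 1) (by omega)).norm.eventually (lt_mem_nhds (half_lt_self (norm_pos_iff.2 hα)))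
  have hsum : ∀ᶠ u in l, ∑ k ∈ Finset.range (n + 1), ‖A u k‖ <
      ∑ k ∈ Finset.range (n + 1), ‖α k‖ + 1 :=
    (tendsto_finsetSum _ fun k hk => (hA k (by have := Finset.mem_range.1 hk; omega)).norm).eventually
      (gt_mem_nhds (lt_add_one _))
  have hm : 0 < ‖α (n + 1)‖ / 2 := half_pos (norm_pos_iff.2 hα)
  set m := ‖α (n + 1)‖ / 2
  set M := ∑ k ∈ Finset.range (n + 1), ‖α k‖ + 1
  refine IsBigO.of_bound (max 1 (M / m)) ?_
  filter_upwards [hlead, hsum, hz] with u h₁ h₂ h₃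
  rw [norm_one, mul_one]
  rcases le_or_gt ‖z u‖ 1 with h | h
  · exact h.trans (le_max_left _ _)
  · refine le_trans ?_ (le_max_right _ _)
    rw [le_div_iff₀ hm]
    rw [Finset.sum_range_succ, add_eq_zero_iff_eq_neg'] at h₃
    have h₄ : ‖A u (n + 1)‖ * ‖z u‖ ^ (n + 1) ≤
        (∑ k ∈ Finset.range (n + 1), ‖A u k‖) * ‖z u‖ ^ n := by
      rw [← norm_pow, ← norm_mul, h₃, norm_neg, Finset.sum_mul]
      refine (norm_sum_le _ _).trans (Finset.sum_le_sum fun k hk => ?_)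
      rw [norm_mul, norm_pow]
      gcongr
      · exact h.le
      · exact Nat.lt_succ_iff.1 (Finset.mem_range.1 hk)
    have h₅ : (‖z u‖ * m) * ‖z u‖ ^ n ≤ M * ‖z u‖ ^ n := by
      calc (‖z u‖ * m) * ‖z u‖ ^ n = m * ‖z u‖ ^ (n + 1) := by ring
        _ ≤ ‖A u (n + 1)‖ * ‖z u‖ ^ (n + 1) := by gcongr
        _ ≤ _ := h₄
        _ ≤ M * ‖z u‖ ^ n := by gcongr
    exact le_of_mul_le_mul_right h₅ (by positivity)

theorem tendsto_zero_of_sum_eq_zero {ι : Type*} {l : Filter ι} {n m : ℕ} {A : ι → ℕ → ℂ}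
    (hm : m < n) (hm0 : m ≠ 0)
    (hA : ∀ k < n, Tendsto (fun u => A u k) l (𝓝 (if k = m then 1 else 0)))
    {z : ι → ℂ} (hzb : z =O[l] fun _ => (1 : ℂ))
    (hz : ∀ᶠ u in l, ∑ k ∈ Finset.range n, A u k * z u ^ k = 0) :
    Tendsto z l (𝓝 0) := by
  have h : Tendsto (fun u => ∑ k ∈ Finset.range n,
      (A u k - if k = m then 1 else 0) * z u ^ k) l (𝓝 (∑ k ∈ Finset.range n, 0)) := by
    refine tendsto_finsetSum _ fun k hk => ?_
    have h₁ : (fun u => A u k - if k = m then 1 else 0) =o[l] fun _ => (1 : ℂ) := by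
      rw [isLittleO_one_iff]
      simpa using (hA k (Finset.mem_range.1 hk)).sub_const (if k = m then 1 else 0)
    simpa [isLittleO_one_iff] using h₁.mul_isBigO (hzb.pow k)
  have h' := h.neg
  rw [Finset.sum_const_zero, neg_zero] at h'
  have hpow : Tendsto (fun u => z u ^ m) l (𝓝 0) := by
    refine h'.congr' ?_
    filter_upwards [hz] with u hu
    simp [sub_mul, hu, Finset.sum_sub_distrib, hm]
  rw [← isLittleO_one_iff ℂ] at hpow ⊢
  exact IsLittleO.of_pow (n := m) (by simpa [Pi.pow_def] using hpow) hm0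

theorem tendsto_parabolaCoeff {ι : Type*} {l : Filter ι} {a : ι → ℕ → ℕ → ℂ} {b : ι → ℂ}
    {a₀ : ℕ → ℕ → ℂ} {N n : ℕ} (hn : n < N)
    (ha : ∀ d < N, ∀ i ≤ d, Tendsto (fun u => a u d i) l (𝓝 (a₀ d i)))
    (hb : Tendsto b l (𝓝 0)) (k : ℕ) :
    Tendsto (fun u => parabolaCoeff (a u) (b u) n k) l (𝓝 (parabolaCoeff a₀ 0 n k)) := by
  refine tendsto_finsetSum _ fun i hi => ?_
  exact (ha _ (by omega) _ (Nat.lt_succ_iff.1 (Finset.mem_range.1 hi))).mul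
    ((hb.pow _).const_mul _)

theorem eq_zero_of_tendsto_w12Coeff {ι : Type*} {l : Filter ι} [l.NeBot] {s : ℂ}
    {a : ι → ℕ → ℕ → ℂ} {b c : ι → ℂ}
    (ha : ∀ d < 9, ∀ i ≤ d, Tendsto (fun u => a u d i) l (𝓝 (w12Coeff s d i)))
    (h₄ : ∀ᶠ u in l, ∑ i ∈ Finset.range 5, a u 4 i * b u ^ i = 0)
    (h₇ : ∀ᶠ u in l, ∑ k ∈ Finset.range 8, parabolaCoeff (a u) (b u) 7 k * c u ^ k = 0)
    (h₈ : ∀ᶠ u in l, ∑ k ∈ Finset.range 9, parabolaCoeff (a u) (b u) 8 k * c u ^ k = 0) :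
    s = 0 := by
  have hb : Tendsto b l (𝓝 0) := by
    have hbO : b =O[l] fun _ => (1 : ℂ) :=
      isBigO_one_of_root (n := 3) (α := w12Coeff s 4)
        (fun k hk => ha 4 (by norm_num) k (by omega)) (by simp [w12Coeff]) h₄
    exact tendsto_zero_of_sum_eq_zero (m := 4) (by norm_num) (by norm_num) (fun k hk => by
      have := ha 4 (by norm_num) k (by omega)
      interval_cases k <;> simpa [w12Coeff] using this) hbO h₄
  have h₇' : ∀ᶠ u in l, ∑ k ∈ Finset.range 4, parabolaCoeff (a u) (b u) 7 k * c u ^ k = 0 := by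
    filter_upwards [h₇] with u hu
    simpa [Finset.sum_range_succ _ 7, Finset.sum_range_succ _ 6, Finset.sum_range_succ _ 5,
      Finset.sum_range_succ _ 4, parabolaCoeff_eq_zero] using hu
  have h₈' : ∀ᶠ u in l, ∑ k ∈ Finset.range 5, parabolaCoeff (a u) (b u) 8 k * c u ^ k = 0 := by
    filter_upwards [h₈] with u hu
    simpa [Finset.sum_range_succ _ 8, Finset.sum_range_succ _ 7, Finset.sum_range_succ _ 6,
      Finset.sum_range_succ _ 5, parabolaCoeff_eq_zero] using hu
  have hP₇ := tendsto_parabolaCoeff (n := 7) (by norm_num) ha hb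
  have hP₈ := tendsto_parabolaCoeff (n := 8) (by norm_num) ha hb
  have hcO : c =O[l] fun _ => (1 : ℂ) :=
    isBigO_one_of_root (n := 3) (fun k _ => hP₈ k)
      (by simp [parabolaCoeff, Finset.sum_range_succ, w12Coeff]) h₈'
  have hc : Tendsto c l (𝓝 0) := by
    exact tendsto_zero_of_sum_eq_zero (m := 2) (by norm_num) (by norm_num) (fun k hk => by
      have := hP₇ k
      interval_cases k <;>
      simpa [parabolaCoeff, Finset.sum_range_succ, w12Coeff] using this) hcO h₇'
  have hlim : Tendsto (fun u => ∑ k ∈ Finset.range 5, parabolaCoeff (a u) (b u) 8 k * c u ^ k) l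
      (𝓝 (∑ k ∈ Finset.range 5, parabolaCoeff (w12Coeff s) 0 8 k * 0 ^ k)) :=
    tendsto_finsetSum _ fun k _ => (hP₈ k).mul (hc.pow k)
  have := tendsto_nhds_unique (hlim.congr' h₈') tendsto_const_nhds
  simpa [parabolaCoeff, Finset.sum_range_succ, w12Coeff] using this

/-- The family W12 does not deform to `J_{3,0}`: for every analytic deformation
`F` of `f` with parameter in `ℂ^m` (m ≥ 1), all nearby nonzero parameter values
give germs not right equivalent to any member of `J_{3,0}`. -/
theorem not_deform_to_J30_W12 (s t : ℂ) (hs : s ≠ 0)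
    (m : ℕ) (hm : 1 ≤ m) (F : (ℂ × ℂ) × EuclideanSpace ℂ (Fin m) → ℂ)
    (hF : AnalyticAt ℂ F 0)
    (hF0 : ∀ᶠ p in nhds (0 : ℂ × ℂ), F (p, 0) = p.1 ^ 4 + p.1 ^ 2 * p.2 ^ 3 + s * p.2 ^ 8 + t * p.2 ^ 9) :
    ∃ ε > (0 : ℝ), ∀ u : EuclideanSpace ℂ (Fin m), 0 < ‖u‖ → ‖u‖ < ε →
      ∀ b c : ℂ, 4 * b ^ 3 + 27 ≠ 0 →
        ¬ RightEquiv (fun p => F (p, u)) (J30 b c) := by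

  by_contra! hcon
  have hbad : ∃ᶠ u in 𝓝 (0 : EuclideanSpace ℂ (Fin m)),
      ∃ β γ : ℂ, RightEquiv (fun p => F (p, u)) (J30 β γ) := by
    rw [Metric.nhds_basis_ball.frequently_iff]
    intro ε hε
    obtain ⟨u, -, hu, β, γ, -, h⟩ := hcon ε hε
    exact ⟨u, by simpa using hu, β, γ, h⟩
  obtain ⟨a, hac, haO⟩ := exists_jet_expansion hF
  have ha0 : ∀ d < 9, ∀ i ≤ d, a 0 d i = w12Coeff s d i := fun d hd i hi =>
    jet_coeff_unique (haO.self_of_nhds 9) ((isBigO_sub_jet_w12Coeff s t).congr'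
      (by filter_upwards [hF0] with p hp; rw [hp]) EventuallyEq.rfl) hd hi
  have ha : ∀ d < 9, ∀ i ≤ d, Tendsto (fun u => a u d i) (𝓝 0) (𝓝 (w12Coeff s d i)) :=
    fun d hd i hi => ha0 d hd i hi ▸ hac d i
  have h44 : ∀ᶠ u in 𝓝 0, a u 4 4 ≠ 0 :=
    (ha 4 (by norm_num) 4 le_rfl).eventually_ne (by simp [w12Coeff])
  set l := 𝓝 (0 : EuclideanSpace ℂ (Fin m)) ⊓
    𝓟 {u | ∃ β γ : ℂ, RightEquiv (fun p => F (p, u)) (J30 β γ)} with hl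
  have : l.NeBot := frequently_mem_iff_neBot.1 hbad
  have hev : ∀ᶠ u in l, ∃ z : ℂ × ℂ, ∑ i ∈ Finset.range 5, a u 4 i * z.1 ^ i = 0 ∧
      ∑ k ∈ Finset.range 8, parabolaCoeff (a u) z.1 7 k * z.2 ^ k = 0 ∧
      ∑ k ∈ Finset.range 9, parabolaCoeff (a u) z.1 8 k * z.2 ^ k = 0 := by
    rw [hl, eventually_inf_principal]
    filter_upwards [haO, h44] with u hO h4 ⟨β, γ, h⟩
    obtain ⟨b, c, hbc⟩ := h.exists_curve (hO 9) h4
    exact ⟨(b, c), hbc⟩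
  obtain ⟨z, hz⟩ := hev.choice
  exact hs (eq_zero_of_tendsto_w12Coeff (l := l) (b := fun u => (z u).1) (c := fun u => (z u).2)
    (fun d hd i hi => (ha d hd i hi).mono_left inf_le_left) (hz.mono fun u h => h.1)
    (hz.mono fun u h => h.2.1) (hz.mono fun u h => h.2.2))
end
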